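/- Let E be a compact Polish space and let 𝒦(E) be the hyperspace of compact subsets of E with the Vietoris topology. Let 𝓕 ⊆ 𝒦(E) be a closed set such that for every K ∈ 𝒦(E) with nonempty interior in E, K* ∩ 𝓕 is nonmeager in 𝓕. Then there exists a set 𝓕' ⊆ 𝒦(E), closed and closed upwards, such that for every K ∈ 𝒦(E), K* ∩ 𝓕' is nonmeager in 𝓕' if and only if K* ∩ 𝓕 is nonmeager in 𝓕. -/

import Mathlib

open TopologicalSpace Set

/-- For `A ⊆ E`, `A* = {K ∈ 𝒦(E) : K ∩ A ≠ ∅}`. Here `𝒦(E)` is modeled by the closed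
(equivalently, compact, since `E` is compact) subsets of `E` with the Hausdorff metric
topology, which coincides with the Vietoris topology for compact metric `E`. -/
def starSet {E : Type*} [TopologicalSpace E] (A : Set E) : Set (Closeds E) :=
  {K : Closeds E | ((K : Set E) ∩ A).Nonempty}

/-- `S` is meager in `F` (in the subspace topology of `F`). -/
def MeagerIn {X : Type*} [TopologicalSpace X] (S F : Set X) : Prop :=
  IsMeagre ((Subtype.val : F → X) ⁻¹' S)

/-- `F'` is closed upwards. -/
def ClosedUpwards {E : Type*} [TopologicalSpace E] (F' : Set (Closeds E)) : Prop :=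
  ∀ A B : Closeds E, A ∈ F' → A ≤ B → B ∈ F'

open Topology

section Basics

variable {E : Type*} [MetricSpace E] [CompactSpace E]

lemma TopologicalSpace.Closeds.isInducing_coe_vietoris :
    @IsInducing (Closeds E) (Set E) _ (TopologicalSpace.vietoris E) ((↑) : Closeds E → Set E) := by
  have hausdorff (B : Closeds E) : 𝓝 B =
      Filter.comap (↑) (@nhds _ (UniformSpace.hausdorff E).toTopologicalSpace (B : Set E)) := by
    let _ := UniformSpace.hausdorff E
    exact Closeds.isUniformEmbedding_coe.isInducing.nhds_eq_comap B
  let _ := TopologicalSpace.vietoris E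
  refine isInducing_iff_nhds.2 fun B => ?_
  rw [hausdorff, B.isClosed.isCompact.nhds_hausdorff_eq_nhds_vietoris]

lemma TopologicalSpace.Closeds.isOpen_subsets_of_isOpen {W : Set E} (hW : IsOpen W) :
    IsOpen {B : Closeds E | (B : Set E) ⊆ W} := by
  let _ := TopologicalSpace.vietoris E
  exact hW.powerset_vietoris.preimage Closeds.isInducing_coe_vietoris.continuous

lemma isClosed_starSet {Q : Set E} (hQ : IsClosed Q) : IsClosed (starSet Q) := by
  rw [← isOpen_compl_iff]
  convert Closeds.isOpen_subsets_of_isOpen hQ.isOpen_compl using 1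
  ext B
  simp [starSet, Set.not_nonempty_iff_eq_empty, ← Set.disjoint_iff_inter_eq_empty,
    Set.subset_compl_iff_disjoint_right]

lemma TopologicalSpace.Closeds.exists_vietoris_nhds {O : Set (Closeds E)} (hO : IsOpen O)
    {B : Closeds E} (hB : B ∈ O) :
    ∃ (W : Set E) (u : Set (Set E)), IsOpen W ∧ u.Finite ∧ (∀ U ∈ u, IsOpen U) ∧
      (B : Set E) ⊆ W ∧ (∀ U ∈ u, ((B : Set E) ∩ U).Nonempty) ∧
      ∀ B' : Closeds E, (B' : Set E) ⊆ W → (∀ U ∈ u, ((B' : Set E) ∩ U).Nonempty) → B' ∈ O := by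
  let _ := TopologicalSpace.vietoris E
  obtain ⟨O', hO', rfl⟩ := Closeds.isInducing_coe_vietoris.isOpen_iff.1 hO
  obtain ⟨_, ⟨u, ⟨huf, huo⟩, rfl⟩, ⟨h1, h2⟩, hu⟩ :=
    vietoris.isTopologicalBasis.exists_subset_of_mem_open (a := (B : Set E)) hB hO'
  exact ⟨⋃₀ u, u, isOpen_sUnion huo, huf, huo, h1, h2, fun B' h h' => hu ⟨h, h'⟩⟩

lemma TopologicalSpace.Closeds.isClosed_upperClosure {C : Set (Closeds E)} (hC : IsClosed C) :
    IsClosed (upperClosure C : Set (Closeds E)) := by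
  have h : IsClosed {p : Closeds E × Closeds E | p.1 ∈ C ∧ p.1 ⊔ p.2 = p.2} :=
    (hC.preimage continuous_fst).inter
      (isClosed_eq (continuous_fst.sup continuous_snd) continuous_snd)
  convert isClosedMap_snd_of_compactSpace _ h using 1
  ext B
  simp [mem_upperClosure]

/-- In a closed family, nonmeagreness of the trace of the closed set `K*` amounts to containing a
nonempty relatively open set. -/
lemma not_meagerIn_starSet_iff {F : Set (Closeds E)} (hF : IsClosed F) (K : Closeds E) :
    ¬ MeagerIn (starSet (K : Set E)) F ↔
      ∃ O : Set (Closeds E), IsOpen O ∧ (F ∩ O).Nonempty ∧ F ∩ O ⊆ starSet (K : Set E) := by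
  have : CompactSpace F := isCompact_iff_compactSpace.1 hF.isCompact
  have hcl : IsClosed ((↑) ⁻¹' starSet (K : Set E) : Set F) :=
    (isClosed_starSet K.isClosed).preimage continuous_subtype_val
  constructor
  · intro hK
    have : (interior ((↑) ⁻¹' starSet (K : Set E) : Set F)).Nonempty := by
      by_contra hne
      exact hK (IsNowhereDense.isMeagre
        (hcl.isNowhereDense_iff.2 (Set.not_nonempty_iff_eq_empty.1 hne)))
    obtain ⟨⟨A, hA⟩, hAi⟩ := this
    obtain ⟨O, hO, hOi⟩ := isOpen_induced_iff.1
      (isOpen_interior (s := ((↑) ⁻¹' starSet (K : Set E) : Set F)))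
    refine ⟨O, hO, ⟨A, hA, ?_⟩, fun B hB => ?_⟩
    · rw [← hOi] at hAi
      exact hAi
    · have : (⟨B, hB.1⟩ : F) ∈ interior ((↑) ⁻¹' starSet (K : Set E) : Set F) := by
        rw [← hOi]
        exact hB.2
      exact (interior_subset this : _ ∈ ((↑) ⁻¹' starSet (K : Set E) : Set F))
  · rintro ⟨O, hO, ⟨A, hA, hAO⟩, hsub⟩ hm
    exact not_isMeagre_of_isOpen (hO.preimage continuous_subtype_val) (⟨⟨A, hA⟩, hAO⟩ :
      ((↑) ⁻¹' O : Set F).Nonempty) (hm.mono fun B hB => hsub ⟨B.2, hB⟩)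

end Basics

lemma exists_isTopologicalBasis_range (X : Type*) [TopologicalSpace X] [SecondCountableTopology X]
    [Nonempty X] : ∃ G : ℕ → Set X, IsTopologicalBasis (range G) := by
  obtain ⟨b, hbc, -, hb⟩ := exists_countable_basis X
  obtain ⟨s, hs, -⟩ := hb.exists_subset_of_mem_open (mem_univ (Classical.arbitrary X)) isOpen_univ
  obtain ⟨G, rfl⟩ := hbc.exists_eq_range ⟨s, hs⟩
  exact ⟨G, hb⟩

/-- A sequence converging to `y` whose terms avoid prescribed sets and which leaves room near its
limit. -/
lemma exists_injective_tendsto {E : Type*} [MetricSpace E] {P : ℕ → Set E} {y : E}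
    (hP : ∀ m, ∀ ε > 0, ∃ z ∉ P m, z ≠ y ∧ dist z y < ε) :
    ∃ j : ℕ → E, Function.Injective j ∧ (∀ m, j m ∉ P m) ∧ (∀ m, j m ≠ y) ∧
      Filter.Tendsto j Filter.atTop (𝓝 y) ∧ y ∈ closure (insert y (range j))ᶜ := by
  have hP' : ∀ m ε, ∃ z, 0 < ε → z ∉ P m ∧ z ≠ y ∧ dist z y < ε := fun m ε => by
    by_cases hε : 0 < ε
    · obtain ⟨z, h⟩ := hP m ε hε
      exact ⟨z, fun _ => h⟩
    · exact ⟨y, fun h => absurd h hε⟩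
  choose g hg using hP'
  let u : ℕ → E := fun n =>
    Nat.rec (g 0 1) (fun n x => g ((n + 1) / 2) (min (1 / ((n + 1 : ℕ) + 1)) (dist x y))) n
  have hu (n : ℕ) : u n ∉ P (n / 2) ∧ u n ≠ y ∧ dist (u n) y < 1 / ((n : ℝ) + 1) := by
    induction n with
    | zero => simpa [u] using hg 0 1 one_pos
    | succ n ih =>
      have := hg ((n + 1) / 2) (min (1 / ((n + 1 : ℕ) + 1)) (dist (u n) y))
        (lt_min (by positivity) (dist_pos.2 ih.2.1))
      exact ⟨this.1, this.2.1, this.2.2.trans_le (min_le_left _ _)⟩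
  have hanti : StrictAnti fun n => dist (u n) y := strictAnti_nat_of_succ_lt fun n =>
    (hg ((n + 1) / 2) (min (1 / ((n + 1 : ℕ) + 1)) (dist (u n) y))
      (lt_min (by positivity) (dist_pos.2 (hu n).2.1))).2.2.trans_le (min_le_right _ _)
  have hinj : Function.Injective u := fun a b hab => hanti.injective (by simp [hab])
  have hlim : Filter.Tendsto u Filter.atTop (𝓝 y) := tendsto_iff_dist_tendsto_zero.2 <|
    squeeze_zero (fun _ => dist_nonneg) (fun n => (hu n).2.2.le)
      tendsto_one_div_add_atTop_nhds_zero_nat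
  have h0 : Filter.Tendsto (fun m : ℕ => 2 * m) Filter.atTop Filter.atTop :=
    Filter.tendsto_atTop_mono (fun m => by simp; omega) Filter.tendsto_id
  have h1 : Filter.Tendsto (fun m : ℕ => 2 * m + 1) Filter.atTop Filter.atTop :=
    Filter.tendsto_atTop_mono (fun m => by simp; omega) Filter.tendsto_id
  refine ⟨fun m => u (2 * m + 1),
    fun a b hab => by have := @hinj (2 * a + 1) (2 * b + 1) hab; omega, fun m => ?_,
    fun m => (hu (2 * m + 1)).2.1, hlim.comp h1, mem_closure_of_tendsto (f := fun m => u (2 * m))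
      (b := Filter.atTop) (hlim.comp h0) (Filter.Eventually.of_forall fun m => ?_)⟩
  · have := (hu (2 * m + 1)).1
    rwa [show (2 * m + 1) / 2 = m by omega] at this
  · rintro (h | ⟨k, hk⟩)
    · exact (hu _).2.1 h
    · have := @hinj (2 * k + 1) (2 * m) hk
      omega

section Coding

variable {E : Type*} [MetricSpace E] [CompactSpace E]

/-- Neighbourhoods of the terms of a sequence which avoid prescribed closed sets and the other
terms, and eventually meet every open subset of `H`. -/
lemma exists_open_separators {P : ℕ → Closeds E} {y : E} {j : ℕ → E} {H : Set E}
    (hPG : ∀ G : Set E, IsOpen G → G.Nonempty → ∀ᶠ m in Filter.atTop, ¬ G ⊆ P m)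
    (hj : Function.Injective j) (hjP : ∀ m, j m ∉ P m) (hjy : ∀ m, j m ≠ y)
    (hlim : Filter.Tendsto j Filter.atTop (𝓝 y)) (hH : H = (insert y (range j))ᶜ) :
    ∃ V : ℕ → Set E, (∀ m, IsOpen (V m)) ∧ (∀ m, j m ∈ V m) ∧
      (∀ m, Disjoint (closure (V m)) (P m)) ∧ (∀ m, y ∉ closure (V m)) ∧
      (∀ m k, k ≠ m → j k ∉ closure (V m)) ∧
      ∀ G : Set E, IsOpen G → (G ∩ H).Nonempty → ∀ᶠ m in Filter.atTop, (V m ∩ G).Nonempty := by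
  have : Nonempty E := ⟨y⟩
  have hHo : IsOpen H := hH ▸ hlim.isCompact_insert_range.isClosed.isOpen_compl
  obtain ⟨G, hG⟩ := exists_isTopologicalBasis_range E
  have key (m : ℕ) : ∃ V : Set E, IsOpen V ∧ j m ∈ V ∧
      closure V ⊆ ((P m : Set E) ∪ insert y (range fun k => if k = m then y else j k))ᶜ ∧
      ∀ i ≤ m, ((G i ∩ H) \ P m).Nonempty → (V ∩ (G i ∩ H)).Nonempty := by
    have hc : IsClosed (insert y (range fun k => if k = m then y else j k)) := by
      refine (Filter.Tendsto.isCompact_insert_range ?_).isClosed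
      refine hlim.congr' ?_
      filter_upwards [Filter.eventually_gt_atTop m] with k hk
      rw [if_neg hk.ne']
    have hs (i : ℕ) : ∃ s, ((G i ∩ H) \ P m).Nonempty → s ∈ (G i ∩ H) \ P m := by
      by_cases hne : ((G i ∩ H) \ P m).Nonempty
      · exact ⟨hne.some, fun _ => hne.some_mem⟩
      · exact ⟨y, fun h => absurd h hne⟩
    choose s hs using hs
    let S : Set E := insert (j m) (s '' {i | i ≤ m ∧ ((G i ∩ H) \ P m).Nonempty})
    have hS : IsClosed S :=
      ((((finite_le_nat m).subset fun i hi => hi.1).image s).insert _).isClosed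
    have hSU : S ⊆ ((P m : Set E) ∪ insert y (range fun k => if k = m then y else j k))ᶜ := by
      rintro _ (rfl | ⟨i, ⟨-, hi⟩, rfl⟩)
      · rintro (h | h | ⟨k, hk⟩)
        · exact hjP m h
        · exact hjy m h
        · by_cases hkm : k = m
          · simp only [hkm, if_true] at hk
            exact hjy m hk.symm
          · simp only [hkm, if_false] at hk
            exact hkm (hj hk)
      · have h1 := hs i hi
        have h2 : s i ∉ insert y (range j) := by
          have := h1.1.2
          rwa [hH] at this
        rintro (h | h | ⟨k, hk⟩)
        · exact h1.2 h
        · exact h2 (Or.inl h)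
        · by_cases hkm : k = m
          · simp only [hkm, if_true] at hk
            exact h2 (Or.inl hk.symm)
          · simp only [hkm, if_false] at hk
            exact h2 (Or.inr ⟨k, hk⟩)
    obtain ⟨V, hV, hSV, hVU⟩ := normal_exists_closure_subset hS
      ((P m).isClosed.union hc).isOpen_compl hSU
    exact ⟨V, hV, hSV (Or.inl rfl), hVU,
      fun i hi hne => ⟨s i, hSV (Or.inr ⟨i, ⟨hi, hne⟩, rfl⟩), (hs i hne).1⟩⟩
  choose V hV hjV hVc hVG using key
  refine ⟨V, hV, hjV, fun m => ?_, fun m hy => hVc m hy (Or.inr (Or.inl rfl)),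
    fun m k hk h => hVc m h (Or.inr (Or.inr ⟨k, by simp [hk]⟩)), fun U hU hne => ?_⟩
  · exact (disjoint_compl_left.mono_left (hVc m)).mono_right subset_union_left
  · obtain ⟨x, hx⟩ := hne
    obtain ⟨_, ⟨i, rfl⟩, hxi, hiU⟩ := hG.exists_subset_of_mem_open hx (hU.inter hHo)
    filter_upwards [Filter.eventually_ge_atTop i,
      hPG (G i) (hG.isOpen ⟨i, rfl⟩) ⟨x, hxi⟩] with m him hm
    obtain ⟨z, hz, hzP⟩ := Set.not_subset.1 hm
    exact (hVG m i him ⟨z, ⟨hz, (hiU hz).2⟩, hzP⟩).mono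
      fun w hw => ⟨hw.1, (hiU hw.2.1).1⟩

/-- Closed families `C m`, each with a small distinguished member, can be coded simultaneously in a
single closed, upwards closed family. -/
lemma exists_upwards_closed_coding {C : ℕ → Set (Closeds E)} {P : ℕ → Closeds E} {y : E}
    (hC : ∀ m, IsClosed (C m)) (hPC : ∀ m, P m ∈ C m)
    (hPy : ∀ m, ∀ ε > 0, ∃ z ∉ P m, z ≠ y ∧ dist z y < ε)
    (hPG : ∀ G : Set E, IsOpen G → G.Nonempty → ∀ᶠ m in Filter.atTop, ¬ G ⊆ P m) :
    ∃ F' : Set (Closeds E), IsClosed F' ∧ ClosedUpwards F' ∧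
      (∀ n (K : Closeds E), C n ⊆ starSet (K : Set E) → ¬ MeagerIn (starSet (K : Set E)) F') ∧
      ∀ K : Closeds E, interior (K : Set E) = ∅ →
        (∀ m (W : Set E), IsOpen W → (∃ A ∈ C m, (A : Set E) ⊆ W) →
          ∃ A ∈ C m, (A : Set E) ⊆ W \ K) →
        MeagerIn (starSet (K : Set E)) F' := by
  obtain ⟨j, hj, hjP, hjy, hlim, hyH⟩ := exists_injective_tendsto (P := fun m => (P m : Set E)) hPy
  obtain ⟨H, hH⟩ : ∃ H, H = (insert y (range j))ᶜ := ⟨_, rfl⟩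
  rw [← hH] at hyH
  have hHo : IsOpen H := hH ▸ hlim.isCompact_insert_range.isClosed.isOpen_compl
  obtain ⟨V, hV, hjV, hVP, hVy, hVj, hVG⟩ := exists_open_separators hPG hj hjP hjy hlim hH
  let Q (m : ℕ) : Set (Closeds E) := starSet (closure (V m)) ∪ upperClosure (C m)
  let F' : Set (Closeds E) := (⋂ m, Q m) ∩ starSet (closure H)
  have hF'c : IsClosed F' := (isClosed_iInter fun m => (isClosed_starSet isClosed_closure).union
    (Closeds.isClosed_upperClosure (hC m))).inter (isClosed_starSet isClosed_closure)
  have hF'u : ClosedUpwards F' := by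
    rintro A B ⟨hA, hA'⟩ hAB
    refine ⟨mem_iInter.2 fun m => ?_, hA'.mono (inter_subset_inter_left _ hAB)⟩
    exact (mem_iInter.1 hA m).imp (fun h => h.mono (inter_subset_inter_left _ hAB))
      fun h => (upperClosure (C m)).upper hAB h
  have tail (W : Set E) (hW : IsOpen W) (hne : (W ∩ H).Nonempty) :
      ∃ (D : Closeds E) (M : ℕ), (D : Set E) ⊆ W ∧ ((D : Set E) ∩ H).Nonempty ∧
        ∀ m ≥ M, ((D : Set E) ∩ V m).Nonempty := by
    obtain ⟨x, hxW, hxH⟩ := hne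
    obtain ⟨ρ, hρ, hball⟩ := Metric.nhds_basis_closedBall.mem_iff.1 (hW.mem_nhds hxW)
    obtain ⟨M, hM⟩ := Filter.eventually_atTop.1 (hVG (Metric.ball x ρ) Metric.isOpen_ball
      ⟨x, Metric.mem_ball_self hρ, hxH⟩)
    refine ⟨⟨Metric.closedBall x ρ, Metric.isClosed_closedBall⟩, M, hball,
      ⟨x, Metric.mem_closedBall_self hρ.le, hxH⟩, fun m hm => ?_⟩
    obtain ⟨z, hzV, hz⟩ := hM m hm
    exact ⟨z, Metric.ball_subset_closedBall hz, hzV⟩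
  have build (D : Closeds E) (M : ℕ) (L : ℕ → Closeds E) (hDH : ((D : Set E) ∩ H).Nonempty)
      (hD : ∀ m ≥ M, ((D : Set E) ∩ V m).Nonempty) (hL : ∀ m < M, L m ∈ Q m) :
      D ⊔ (Finset.range M).sup L ∈ F' := by
    refine ⟨mem_iInter.2 fun m => ?_, hDH.mono (inter_subset_inter
      (le_sup_left : D ≤ D ⊔ (Finset.range M).sup L) subset_closure)⟩
    rcases lt_or_ge m M with hm | hm
    · have hle : L m ≤ D ⊔ (Finset.range M).sup L :=
        (Finset.le_sup (Finset.mem_range.2 hm)).trans le_sup_right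
      exact (hL m hm).imp (fun h => h.mono (inter_subset_inter_left _ hle))
        fun h => (upperClosure (C m)).upper hle h
    · exact Or.inl ((hD m hm).mono (inter_subset_inter
        (le_sup_left : D ≤ D ⊔ (Finset.range M).sup L) subset_closure))
  have sup_sub (D : Closeds E) (M : ℕ) (L : ℕ → Closeds E) (S : Set E) (hD : (D : Set E) ⊆ S)
      (hL : ∀ m < M, (L m : Set E) ⊆ S) :
      ((D ⊔ (Finset.range M).sup L : Closeds E) : Set E) ⊆ S := by
    rw [Closeds.coe_sup, Closeds.coe_finset_sup, union_subset_iff]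
    refine ⟨hD, ?_⟩
    simpa [Finset.sup_eq_iSup] using hL
  refine ⟨F', hF'c, hF'u, fun n K hK => ?_, fun K hKi hK => ?_⟩
  · rw [not_meagerIn_starSet_iff hF'c]
    have hW : IsOpen (closure (V n))ᶜ := isClosed_closure.isOpen_compl
    refine ⟨_, Closeds.isOpen_subsets_of_isOpen hW, ?_, ?_⟩
    · obtain ⟨D, M, hDW, hDH, hD⟩ := tail _ hW (mem_closure_iff.1 hyH _ hW (hVy n))
      refine ⟨_, build D M (fun m => if m = n then P n else {j m}) hDH hD fun m _ => ?_,
        sup_sub _ _ _ _ hDW fun m _ => ?_⟩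
      · split_ifs with hmn
        · subst hmn
          exact Or.inr (subset_upperClosure (hPC m))
        · exact Or.inl ⟨j m, by simp, subset_closure (hjV m)⟩
      · split_ifs with hmn
        · exact (hVP n).symm.subset_compl_right
        · simpa using hVj n m hmn
    · rintro B ⟨⟨hB, -⟩, hBW⟩
      rcases mem_iInter.1 hB n with ⟨z, hz, hzV⟩ | ⟨A, hA, hAB⟩
      · exact absurd hzV (hBW hz)
      · exact (hK hA).mono (inter_subset_inter_left _ hAB)
  · by_contra hne
    obtain ⟨O, hO, ⟨B, hBF, hBO⟩, hOK⟩ := (not_meagerIn_starSet_iff hF'c K).1 hne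
    obtain ⟨W, u, hW, huf, huo, hBW, hBu, hWu⟩ := Closeds.exists_vietoris_nhds hO hBO
    have diff (U : Set E) (hU : IsOpen U) (hUne : U.Nonempty) : (U \ (K : Set E)).Nonempty := by
      by_contra hcon
      have hUK : U ⊆ interior (K : Set E) :=
        interior_maximal (sdiff_eq_empty.1 (not_nonempty_iff_eq_empty.1 hcon)) hU
      rw [hKi] at hUK
      exact hUne.ne_empty (subset_empty_iff.1 hUK)
    have hit (U : Set E) (hU : IsOpen U) (h : ((B : Set E) ∩ closure U).Nonempty) :
        ((W \ (K : Set E)) ∩ U).Nonempty := by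
      obtain ⟨z, hzB, hzU⟩ := h
      obtain ⟨w, hw, hwK⟩ := diff _ (hW.inter hU) (mem_closure_iff.1 hzU W hW (hBW hzB))
      exact ⟨w, ⟨hw.1, hwK⟩, hw.2⟩
    obtain ⟨D, M, hDW, hDH, hD⟩ := tail _ (hW.sdiff K.isClosed) (hit H hHo hBF.2)
    have hL (m : ℕ) : ∃ L ∈ Q m, (L : Set E) ⊆ W \ K := by
      rcases mem_iInter.1 hBF.1 m with h | ⟨A, hA, hAB⟩
      · obtain ⟨w, hw, hwV⟩ := hit _ (hV m) h
        exact ⟨{w}, Or.inl ⟨w, by simp, subset_closure hwV⟩, by simpa using hw⟩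
      · obtain ⟨A', hA', hA'W⟩ := hK m W hW ⟨A, hA, fun z hz => hBW (hAB hz)⟩
        exact ⟨A', Or.inr (subset_upperClosure hA'), hA'W⟩
    choose L hLQ hLW using hL
    have hpt (U : u) : ((W \ (K : Set E)) ∩ U).Nonempty := hit U (huo U U.2)
      ((hBu U U.2).mono (inter_subset_inter_right _ subset_closure))
    choose p hp using hpt
    have := huf.to_subtype
    let T : Closeds E := ⟨range p, (finite_range p).isClosed⟩
    have hB'F : (D ⊔ (Finset.range M).sup L) ⊔ T ∈ F' :=
      hF'u _ _ (build D M L hDH hD fun m _ => hLQ m) le_sup_left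
    have hB'W : (((D ⊔ (Finset.range M).sup L) ⊔ T : Closeds E) : Set E) ⊆ W \ K := by
      rw [Closeds.coe_sup]
      refine union_subset (sup_sub D M L _ hDW fun m _ => hLW m) ?_
      rintro _ ⟨U, rfl⟩
      exact (hp U).1
    obtain ⟨z, hz, hzK⟩ := hOK ⟨hB'F, hWu _ (hB'W.trans sdiff_subset) fun U hU =>
      ⟨p ⟨U, hU⟩, Or.inr ⟨_, rfl⟩, (hp ⟨U, hU⟩).2⟩⟩
    exact (hB'W hz).2 hzK

end Coding

/-- The complement of `X` is a point-finite union of a sequence of closed sets. -/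
lemma exists_closeds_annuli {E : Type*} [MetricSpace E] {X : Set E} (hX : IsClosed X)
    (hne : X.Nonempty) :
    ∃ Θ : ℕ → Closeds E, (∀ k, Disjoint (Θ k : Set E) X) ∧ (∀ x ∉ X, ∃ k, x ∈ Θ k) ∧
      ∀ x, ∀ᶠ k in Filter.atTop, x ∉ Θ k := by
  have hd : Continuous fun x => Metric.infDist x X := Metric.continuous_infDist_pt X
  refine ⟨fun k => ⟨{x | 1 ≤ ((k : ℝ) + 1) * Metric.infDist x X ∧ k * Metric.infDist x X ≤ 1},
    (isClosed_le continuous_const (continuous_const.mul hd)).inter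
      (isClosed_le (continuous_const.mul hd) continuous_const)⟩, fun k => ?_, fun x hx => ?_,
    fun x => ?_⟩
  · refine Set.disjoint_left.2 fun x hx hxX => ?_
    have := hx.1
    rw [Metric.infDist_zero_of_mem hxX] at this
    norm_num at this
  · have hpos : 0 < Metric.infDist x X := (hX.notMem_iff_infDist_pos hne).1 hx
    refine ⟨⌊1 / Metric.infDist x X⌋₊, ?_, ?_⟩
    · exact ((div_lt_iff₀ hpos).1 (Nat.lt_floor_add_one _)).le
    · exact (le_div_iff₀ hpos).1 (Nat.floor_le (by positivity))
  · rcases (Metric.infDist_nonneg (x := x) (s := X)).eq_or_lt with h0 | hpos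
    · refine Filter.Eventually.of_forall fun k hk => ?_
      have := hk.1
      rw [← h0] at this
      norm_num at this
    · filter_upwards [Filter.eventually_gt_atTop ⌈1 / Metric.infDist x X⌉₊] with k hk hxk
      exact absurd hxk.2 (not_le.2 ((div_lt_iff₀ hpos).1 (Nat.lt_of_ceil_lt hk)))

section Pieces

variable {E : Type*} [MetricSpace E] [CompactSpace E]

/-- If no nonempty open subset of `X` forces nonmeager traces, then generic members of `F` have
trace with empty interior on `X`. -/
lemma exists_mem_interior_inter_eq_empty {F U : Set (Closeds E)} {X : Set E} (hF : IsClosed F)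
    (hU : IsOpen U) (hne : (F ∩ U).Nonempty)
    (hX : ∀ G : Set E, IsOpen G → G.Nonempty → G ⊆ X →
      ∃ K : Closeds E, ((K : Set E) ∩ G).Nonempty ∧ MeagerIn (starSet (K : Set E)) F) :
    ∃ A ∈ F ∩ U, interior ((A : Set E) ∩ X) = ∅ := by
  by_contra! hcon
  have : CompactSpace F := isCompact_iff_compactSpace.1 hF.isCompact
  obtain ⟨A₀, hA₀F, hA₀U⟩ := hne
  obtain ⟨b, hbc, hb0, hb⟩ := exists_countable_basis E
  let Z (G : Set E) : Set (Closeds E) := {A | G ⊆ (A : Set E) ∩ X}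
  have hZ (G : Set E) : IsClosed (Z G) := by
    by_cases hGX : G ⊆ X
    · have : Z G = ⋂ x ∈ G, starSet {x} := by
        ext A
        simp only [Z, mem_ofPred_eq, subset_inter_iff, hGX, and_true, starSet, mem_iInter,
          inter_singleton_nonempty]
        rfl
      rw [this]
      exact isClosed_biInter fun x _ => isClosed_starSet isClosed_singleton
    · have : Z G = ∅ := eq_empty_of_forall_notMem fun A hA => hGX (hA.trans inter_subset_right)
      rw [this]
      exact isClosed_empty
  have hnm := not_isMeagre_of_isOpen (hU.preimage (continuous_subtype_val (p := (· ∈ F))))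
    ⟨⟨A₀, hA₀F⟩, hA₀U⟩
  have hcov : ((↑) ⁻¹' U : Set F) ⊆ ⋃ G : b, ((↑) ⁻¹' Z G : Set F) := by
    rintro ⟨A, hA⟩ hAU
    obtain ⟨x, hx⟩ := hcon A ⟨hA, hAU⟩
    obtain ⟨G, hG, -, hGA⟩ := hb.exists_subset_of_mem_open hx isOpen_interior
    exact mem_iUnion.2 ⟨⟨G, hG⟩, hGA.trans interior_subset⟩
  have : ∃ G ∈ b, (interior ((↑) ⁻¹' Z G : Set F)).Nonempty := by
    by_contra! hZi
    have := hbc.to_subtype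
    refine hnm ((isMeagre_iUnion fun G : b => ?_).mono hcov)
    exact (((hZ G).preimage continuous_subtype_val).isNowhereDense_iff.2 (hZi G G.2)).isMeagre
  obtain ⟨G, hG, A, hA⟩ := this
  obtain ⟨O, hO, hOi⟩ := isOpen_induced_iff.1 (isOpen_interior (s := ((↑) ⁻¹' Z G : Set F)))
  rw [← hOi] at hA
  have hOZ : F ∩ O ⊆ Z G := fun B hB => by
    have hB' : (⟨B, hB.1⟩ : F) ∈ ((↑) ⁻¹' O : Set F) := hB.2
    rw [hOi] at hB'
    exact (interior_subset hB' : _ ∈ ((↑) ⁻¹' Z G : Set F))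
  obtain ⟨K, ⟨z, hzK, hzG⟩, hK⟩ := hX G (hb.isOpen hG)
    (nonempty_iff_ne_empty.2 fun h => hb0 (h ▸ hG)) ((hOZ ⟨A.2, hA⟩).trans inter_subset_right)
  exact (not_meagerIn_starSet_iff hF K).2 ⟨O, hO, ⟨A, A.2, hA⟩,
    fun B hB => ⟨z, (hOZ hB hzG).1, hzK⟩⟩ hK

/-- The traces on `X` of the members of `F ∩ U` generate a closed family which still detects the
nonmeager traces witnessed by `U`, and no new ones. -/
lemma exists_closed_traces {F U : Set (Closeds E)} {X : Set E} (hF : IsClosed F)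
    (hU : IsOpen U) (hXc : IsClosed X)
    (hX : ∀ G : Set E, IsOpen G → G.Nonempty → G ⊆ X →
      ∃ K : Closeds E, ((K : Set E) ∩ G).Nonempty ∧ MeagerIn (starSet (K : Set E)) F) :
    ∃ (C : Set (Closeds E)) (P : Closeds E), IsClosed C ∧ P ∈ C ∧ interior (P : Set E) = ∅ ∧
      ((F ∩ U).Nonempty → ∀ K : Closeds E, (K : Set E) ⊆ X → F ∩ U ⊆ starSet (K : Set E) →
        C ⊆ starSet (K : Set E)) ∧
      ∀ K : Closeds E, (K : Set E) ⊆ X → MeagerIn (starSet (K : Set E)) F →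
        ∀ W : Set E, IsOpen W → (∃ A ∈ C, (A : Set E) ⊆ W) → ∃ A ∈ C, (A : Set E) ⊆ W \ K := by
  by_cases hne : (F ∩ U).Nonempty
  swap
  · exact ⟨{⊥}, ⊥, isClosed_singleton, rfl, by simp, fun h => absurd h hne,
      fun K _ _ W _ _ => ⟨⊥, rfl, by simp⟩⟩
  obtain ⟨A₁, hA₁, hA₁X⟩ := exists_mem_interior_inter_eq_empty hF hU hne hX
  let t (A : Closeds E) : Closeds E := A ⊓ ⟨X, hXc⟩
  have ht (A : Closeds E) : (t A : Set E) = (A : Set E) ∩ X := rfl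
  refine ⟨closure (t '' (F ∩ U)), t A₁, isClosed_closure, subset_closure ⟨A₁, hA₁, rfl⟩, hA₁X,
    fun _ K hKX hK => closure_minimal ?_ (isClosed_starSet K.isClosed), ?_⟩
  · rintro _ ⟨A, hA, rfl⟩
    obtain ⟨z, hzA, hzK⟩ := hK hA
    exact ⟨z, ⟨hzA, hKX hzK⟩, hzK⟩
  · rintro K hKX hK W hW ⟨A, hA, hAW⟩
    obtain ⟨_, hBW, B, hB, rfl⟩ := mem_closure_iff.1 hA _ (Closeds.isOpen_subsets_of_isOpen hW) hAW
    have hB' : (B : Set E) ⊆ W ∪ Xᶜ := fun z hz => by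
      by_cases hzX : z ∈ X
      · exact Or.inl (hBW ⟨hz, hzX⟩)
      · exact Or.inr hzX
    have hO := hU.inter (Closeds.isOpen_subsets_of_isOpen (hW.union hXc.isOpen_compl))
    have hsub : ¬ F ∩ (U ∩ {B : Closeds E | (B : Set E) ⊆ W ∪ Xᶜ}) ⊆ starSet (K : Set E) :=
      fun hsub => (not_meagerIn_starSet_iff hF K).2 ⟨_, hO, ⟨B, hB.1, hB.2, hB'⟩, hsub⟩ hK
    obtain ⟨D, ⟨hDF, hDU, hDW⟩, hDK⟩ := Set.not_subset.1 hsub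
    refine ⟨t D, subset_closure ⟨D, ⟨hDF, hDU⟩, rfl⟩, fun z hz => ⟨?_, fun hzK => ?_⟩⟩
    · exact (hDW hz.1).resolve_right fun h => h hz.2
    · exact hDK ⟨z, hz.1, hzK⟩

end Pieces

/-- If every compact set with nonempty interior has nonmeager trace on the closed set `𝓕`,
then `𝓕` admits a closed, upwards closed replacement with the same nonmeager traces. -/
theorem exists_upwards_closed_representative {E : Type*} [MetricSpace E] [CompactSpace E]
    (F : Set (Closeds E)) (hF : IsClosed F)
    (h : ∀ K : Closeds E, (interior (K : Set E)).Nonempty →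
      ¬ MeagerIn (starSet (K : Set E)) F) :
    ∃ F' : Set (Closeds E), IsClosed F' ∧ ClosedUpwards F' ∧
      ∀ K : Closeds E,
        (¬ MeagerIn (starSet (K : Set E)) F' ↔ ¬ MeagerIn (starSet (K : Set E)) F) := by
  let O : Set E := ⋃₀ {G | IsOpen G ∧
    ∀ K : Closeds E, ((K : Set E) ∩ G).Nonempty → ¬ MeagerIn (starSet (K : Set E)) F}
  have hO : IsOpen O := isOpen_sUnion fun G hG => hG.1
  have hKO (K : Closeds E) (hK : ((K : Set E) ∩ O).Nonempty) :
      ¬ MeagerIn (starSet (K : Set E)) F := by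
    obtain ⟨z, hzK, G, hG, hzG⟩ := hK
    exact hG.2 K ⟨z, hzK, hzG⟩
  rcases (Oᶜ).eq_empty_or_nonempty with hX | ⟨y, hy⟩
  · rw [compl_empty_iff] at hX
    refine ⟨{⊤}, isClosed_singleton, ?_, fun K => ?_⟩
    · rintro A B rfl hAB
      exact top_le_iff.1 hAB
    · constructor
      · intro hK
        obtain ⟨_, _, ⟨A, hA⟩, hsub⟩ := (not_meagerIn_starSet_iff isClosed_singleton K).1 hK
        obtain ⟨z, -, hz⟩ := hsub hA
        exact hKO K ⟨z, hz, hX ▸ mem_univ z⟩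
      · intro hK
        obtain ⟨_, _, ⟨A, hA⟩, hsub⟩ := (not_meagerIn_starSet_iff hF K).1 hK
        obtain ⟨z, -, hz⟩ := hsub hA
        refine (not_meagerIn_starSet_iff isClosed_singleton K).2
          ⟨univ, isOpen_univ, ⟨⊤, rfl, mem_univ _⟩, ?_⟩
        rintro _ ⟨rfl, -⟩
        exact ⟨z, mem_univ z, hz⟩
  have hXc : IsClosed Oᶜ := hO.isClosed_compl
  have hXG (G : Set E) (hG : IsOpen G) (hne : G.Nonempty) (hGX : G ⊆ Oᶜ) :
      ∃ K : Closeds E, ((K : Set E) ∩ G).Nonempty ∧ MeagerIn (starSet (K : Set E)) F := by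
    by_contra! hcon
    exact hGX hne.some_mem ⟨G, ⟨hG, hcon⟩, hne.some_mem⟩
  have hiso (G : Set E) (hG : IsOpen G) (hyG : y ∈ G) : (G \ {y}).Nonempty := by
    by_contra hcon
    have hGy : G = {y} := (sdiff_eq_empty.1 (not_nonempty_iff_eq_empty.1 hcon)).antisymm
      (singleton_subset_iff.2 hyG)
    refine hy ⟨G, ⟨hG, fun K hK => h K ⟨y, ?_⟩⟩, hyG⟩
    rw [hGy] at hK hG
    exact interior_maximal (by simpa using hK) hG rfl
  obtain ⟨Θ, hΘX, hΘO, hΘfin⟩ := exists_closeds_annuli hXc ⟨y, hy⟩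
  obtain ⟨U, hU⟩ := exists_isTopologicalBasis_range (Closeds E)
  choose C P hC hPC hPi hCa hCb using fun n =>
    exists_closed_traces hF (hU.isOpen ⟨n, rfl⟩) hXc hXG
  let C' (m : ℕ) : Set (Closeds E) := if Even m then C (m / 2) else {Θ (m / 2)}
  let P' (m : ℕ) : Closeds E := if Even m then P (m / 2) else Θ (m / 2)
  have hC'0 (n : ℕ) : C' (2 * n) = C n := by simp [C']
  have hC'1 (n : ℕ) : C' (2 * n + 1) = {Θ n} := by
    simp [C', show (2 * n + 1) / 2 = n by omega]
  have hP'0 (n : ℕ) : P' (2 * n) = P n := by simp [P']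
  have hP'1 (n : ℕ) : P' (2 * n + 1) = Θ n := by
    simp [P', show (2 * n + 1) / 2 = n by omega]
  have hPG (n : ℕ) (G : Set E) (hG : IsOpen G) (hne : G.Nonempty) : ¬ G ⊆ P n := fun hGP => by
    have := interior_maximal hGP hG
    rw [hPi] at this
    exact hne.ne_empty (subset_empty_iff.1 this)
  obtain ⟨F', hF', hF'u, hF'a, hF'b⟩ := exists_upwards_closed_coding (C := C') (P := P') (y := y)
    (fun m => by
      obtain ⟨n, rfl | rfl⟩ := m.even_or_odd'
      · rw [hC'0]
        exact hC n
      · rw [hC'1]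
        exact isClosed_singleton)
    (fun m => by
      obtain ⟨n, rfl | rfl⟩ := m.even_or_odd'
      · rw [hC'0, hP'0]
        exact hPC n
      · rw [hC'1, hP'1]
        rfl)
    (fun m ε hε => by
      obtain ⟨n, rfl | rfl⟩ := m.even_or_odd'
      · rw [hP'0]
        obtain ⟨z, ⟨hz, hzy⟩, hzP⟩ := Set.not_subset.1 (hPG n _
          (Metric.isOpen_ball.sdiff isClosed_singleton)
          (hiso _ Metric.isOpen_ball (Metric.mem_ball_self hε)))
        exact ⟨z, hzP, hzy, hz⟩
      · rw [hP'1]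
        obtain ⟨z, ⟨hz, hzP⟩, hzy⟩ := hiso _ (Metric.isOpen_ball.sdiff (Θ n).isClosed)
          ⟨Metric.mem_ball_self hε, fun hyn => Set.disjoint_left.1 (hΘX n) hyn hy⟩
        exact ⟨z, hzP, hzy, hz⟩)
    (fun G hG ⟨x, hx⟩ => by
      obtain ⟨N, hN⟩ := Filter.eventually_atTop.1 (hΘfin x)
      filter_upwards [Filter.eventually_ge_atTop (2 * N)] with m hm
      obtain ⟨n, rfl | rfl⟩ := m.even_or_odd'
      · rw [hP'0]
        exact hPG n G hG ⟨x, hx⟩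
      · rw [hP'1]
        exact fun hGΘ => hN n (by omega) (hGΘ hx))
  refine ⟨F', hF', hF'u, fun K => not_congr ⟨fun hK => ?_, fun hK => ?_⟩⟩
  · by_contra hKF
    by_cases hKO' : ((K : Set E) ∩ O).Nonempty
    · obtain ⟨z, hzK, hzO⟩ := hKO'
      obtain ⟨k, hk⟩ := hΘO z (not_not.2 hzO)
      refine hF'a (2 * k + 1) K ?_ hK
      rw [hC'1, singleton_subset_iff]
      exact ⟨z, hk, hzK⟩
    · have hKX : (K : Set E) ⊆ Oᶜ := fun z hz hzO => hKO' ⟨z, hz, hzO⟩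
      obtain ⟨S, hS, ⟨A, hAF, hAS⟩, hsub⟩ := (not_meagerIn_starSet_iff hF K).1 hKF
      obtain ⟨_, ⟨n, rfl⟩, hAn, hnS⟩ := hU.exists_subset_of_mem_open hAS hS
      refine hF'a (2 * n) K ?_ hK
      rw [hC'0]
      exact hCa n ⟨A, hAF, hAn⟩ K hKX ((inter_subset_inter_right _ hnS).trans hsub)
  · have hKX : (K : Set E) ⊆ Oᶜ := fun z hz hzO => hKO K ⟨z, hz, hzO⟩ hK
    refine hF'b K (not_nonempty_iff_eq_empty.1 fun hne => h K hne hK) fun m W hW => ?_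
    obtain ⟨n, rfl | rfl⟩ := m.even_or_odd'
    · rw [hC'0]
      exact hCb n K hKX hK W hW
    · rw [hC'1]
      rintro ⟨_, rfl, hA⟩
      exact ⟨_, rfl, fun z hz => ⟨hA hz, fun hzK =>
        Set.disjoint_left.1 (hΘX n) hz (hKX hzK)⟩⟩
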